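/- arXiv:0810.0324 — 5 statements merged into one kernel-verified Lean document; each statement's English description precedes it below -/
import Mathlib

section
/- Let k be a field, let n ≥ 0 be an integer, and let X be a separated scheme of finite type over k admitting a finite open cover X = U₁ ∪ ⋯ ∪ U_r (with r ≥ 1) such that each open subscheme Uᵢ is isomorphic over k to affine n-space 𝔸ⁿ_k and such that for all i, j the open subscheme Uᵢ ∩ Uⱼ has a k-point. Then for every field extension L of k, X has an L-point and any two L-points of X are A¹-equivalent (in particular, X is A¹-chain connected). -/
open AlgebraicGeometry CategoryTheory CategoryTheory.Limits

noncomputable section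

/-- The morphism `Spec S ⟶ Spec R` induced by a ring homomorphism `R →+* S`. -/
def specMapOf {R S : Type} [CommRing R] [CommRing S] (f : R →+* S) :
    Spec (CommRingCat.of S) ⟶ Spec (CommRingCat.of R) :=
  Spec.map (CommRingCat.ofHom f)

/-- Two `L`-points `x₀, x₁` of a `k`-scheme `(X, sX)` (where the `k`-algebra structure of `L`
is recorded by the ring homomorphism `φ : k →+* L`) are *elementarily `𝔸¹`-equivalent* if there
is a `k`-morphism `f : 𝔸¹_L = Spec L[T] ⟶ X` with `f ∘ i₀ = x₀` and `f ∘ i₁ = x₁`, where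
`i₀, i₁ : Spec L ⟶ 𝔸¹_L` are the sections induced by evaluation of polynomials at `0` resp. `1`. -/
def ElemA1Equiv (k : Type) [Field k] (L : Type) [Field L] (φ : k →+* L)
    (X : Scheme) (sX : X ⟶ Spec (CommRingCat.of k))
    (x₀ x₁ : Spec (CommRingCat.of L) ⟶ X) : Prop :=
  ∃ f : Spec (CommRingCat.of (Polynomial L)) ⟶ X,
    f ≫ sX = specMapOf ((Polynomial.C : L →+* Polynomial L).comp φ) ∧
    specMapOf (Polynomial.evalRingHom (0 : L)) ≫ f = x₀ ∧
    specMapOf (Polynomial.evalRingHom (1 : L)) ≫ f = x₁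

/-- `𝔸¹`-equivalence of `L`-points: the equivalence relation generated by elementary
`𝔸¹`-equivalence. -/
def A1Equiv (k : Type) [Field k] (L : Type) [Field L] (φ : k →+* L)
    (X : Scheme) (sX : X ⟶ Spec (CommRingCat.of k))
    (x₀ x₁ : Spec (CommRingCat.of L) ⟶ X) : Prop :=
  Relation.EqvGen (ElemA1Equiv k L φ X sX) x₀ x₁

lemma specMapOf_comp {R S T : Type} [CommRing R] [CommRing S] [CommRing T]
    (f : R →+* S) (g : S →+* T) : specMapOf (g.comp f) = specMapOf g ≫ specMapOf f := by
  simp [specMapOf, CommRingCat.ofHom_comp]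

lemma specMapOf_injective {R S : Type} [CommRing R] [CommRing S] :
    Function.Injective (specMapOf : (R →+* S) → _) := fun _ _ h ↦
  congrArg CommRingCat.Hom.hom (Spec.map_injective h)

lemma specMapOf_surjective {R S : Type} [CommRing R] [CommRing S] :
    Function.Surjective (specMapOf : (R →+* S) → _) := fun f ↦
  ⟨(Spec.preimage f).hom, by simp [specMapOf]⟩

/-- Two ring homomorphisms from a polynomial ring which agree on constants are joined by a line. -/
lemma MvPolynomial.exists_line {σ k L : Type} [CommRing k] [CommRing L]
    (φ : k →+* L) (a b : MvPolynomial σ k →+* L)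
    (ha : a.comp MvPolynomial.C = φ) (hb : b.comp MvPolynomial.C = φ) :
    ∃ h : MvPolynomial σ k →+* Polynomial L,
      h.comp MvPolynomial.C = Polynomial.C.comp φ ∧
      (Polynomial.evalRingHom 0).comp h = a ∧ (Polynomial.evalRingHom 1).comp h = b := by
  refine ⟨MvPolynomial.eval₂Hom (Polynomial.C.comp φ) fun i ↦
    Polynomial.C (a (.X i)) + Polynomial.X * Polynomial.C (b (.X i) - a (.X i)), ?_, ?_, ?_⟩
  · ext; simp
  · ext r
    · simpa using (RingHom.congr_fun ha r).symm
    · simp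
  · ext r
    · simpa using (RingHom.congr_fun hb r).symm
    · simp

/-- Two `L`-points of `X` which lift to affine space along a `k`-morphism `𝔸ⁿ_k ⟶ X` are
elementarily `𝔸¹`-equivalent. -/
lemma elemA1Equiv_of_affineSpace {k L σ : Type} [Field k] [Field L] {φ : k →+* L}
    {X : Scheme} {sX : X ⟶ Spec (CommRingCat.of k)}
    (g : Spec (CommRingCat.of (MvPolynomial σ k)) ⟶ X)
    (hg : g ≫ sX = specMapOf (MvPolynomial.C : k →+* MvPolynomial σ k))
    (y₀ y₁ : Spec (CommRingCat.of L) ⟶ Spec (CommRingCat.of (MvPolynomial σ k)))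
    (h₀ : (y₀ ≫ g) ≫ sX = specMapOf φ) (h₁ : (y₁ ≫ g) ≫ sX = specMapOf φ) :
    ElemA1Equiv k L φ X sX (y₀ ≫ g) (y₁ ≫ g) := by
  obtain ⟨a, rfl⟩ := specMapOf_surjective y₀
  obtain ⟨b, rfl⟩ := specMapOf_surjective y₁
  rw [Category.assoc, hg, ← specMapOf_comp] at h₀ h₁
  obtain ⟨h, hC, ha, hb⟩ := MvPolynomial.exists_line φ a b
    (specMapOf_injective h₀) (specMapOf_injective h₁)
  refine ⟨specMapOf h ≫ g, ?_, ?_, ?_⟩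
  · rw [Category.assoc, hg, ← specMapOf_comp, hC]
  · rw [← Category.assoc, ← specMapOf_comp, ha]
  · rw [← Category.assoc, ← specMapOf_comp, hb]

/-- Two `L`-points of `X` which lie in an open subscheme isomorphic to affine space are
elementarily `𝔸¹`-equivalent. -/
lemma elemA1Equiv_of_opens {k L σ : Type} [Field k] [Field L] {φ : k →+* L}
    {X : Scheme} {sX : X ⟶ Spec (CommRingCat.of k)} {V : X.Opens}
    (e : V.toScheme ≅ Spec (CommRingCat.of (MvPolynomial σ k)))
    (he : e.hom ≫ specMapOf (MvPolynomial.C : k →+* MvPolynomial σ k) = V.ι ≫ sX)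
    {x₀ x₁ : Spec (CommRingCat.of L) ⟶ X}
    (h₀ : x₀ ≫ sX = specMapOf φ) (h₁ : x₁ ≫ sX = specMapOf φ)
    (hV₀ : Set.range x₀ ⊆ V) (hV₁ : Set.range x₁ ⊆ V) :
    ElemA1Equiv k L φ X sX x₀ x₁ := by
  have lift_eq (x : Spec (CommRingCat.of L) ⟶ X) (hx : Set.range x ⊆ V) :
      ∃ y, y ≫ e.inv ≫ V.ι = x :=
    ⟨IsOpenImmersion.lift V.ι x (by simpa using hx) ≫ e.hom, by simp⟩
  obtain ⟨y₀, rfl⟩ := lift_eq x₀ hV₀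
  obtain ⟨y₁, rfl⟩ := lift_eq x₁ hV₁
  exact elemA1Equiv_of_affineSpace _ (by rw [Category.assoc, ← he, e.inv_hom_id_assoc]) _ _ h₀ h₁

lemma exists_range_subset_of_iSup_eq_top {L : Type} [Field L] {X : Scheme} {ι : Type*}
    {U : ι → X.Opens} (hU : ⨆ i, U i = ⊤) (x : Spec (CommRingCat.of L) ⟶ X) :
    ∃ i, Set.range x ⊆ U i := by
  have : Unique (Spec (CommRingCat.of L)) := inferInstanceAs (Unique (PrimeSpectrum L))
  obtain ⟨i, hi⟩ := TopologicalSpace.Opens.mem_iSup.mp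
    (hU.ge (TopologicalSpace.Opens.mem_top (x default)))
  refine ⟨i, ?_⟩
  rintro _ ⟨y, rfl⟩
  rwa [Subsingleton.elim y default]

/-- If `X` is a separated finite-type `k`-scheme admitting a finite open cover by copies of
affine `n`-space over `k` such that any two members of the cover intersect in an open subscheme
containing a `k`-point, then for every field extension `L/k` the scheme `X` has an `L`-point and
any two `L`-points of `X` are `𝔸¹`-equivalent; in particular `X` is `𝔸¹`-chain connected. -/
theorem coveredByAffineSpaces_A1ChainConnected
    (k : Type) [Field k] (n r : ℕ) (hr : 0 < r)
    (X : Scheme) (sX : X ⟶ Spec (CommRingCat.of k))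
    (hsep : IsSeparated sX) (hlft : LocallyOfFiniteType sX) (hqc : QuasiCompact sX)
    (U : Fin r → X.Opens)
    (hcover : (⨆ i, U i) = ⊤)
    (haff : ∀ i, ∃ e : (U i).toScheme ≅ Spec (CommRingCat.of (MvPolynomial (Fin n) k)),
      e.hom ≫ specMapOf (MvPolynomial.C : k →+* MvPolynomial (Fin n) k) = (U i).ι ≫ sX)
    (hpt : ∀ i j, ∃ p : Spec (CommRingCat.of k) ⟶ (U i ⊓ U j : X.Opens).toScheme,
      p ≫ (U i ⊓ U j : X.Opens).ι ≫ sX = specMapOf (RingHom.id k)) :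
    ∀ (L : Type) [Field L] [Algebra k L],
      (∃ x : Spec (CommRingCat.of L) ⟶ X, x ≫ sX = specMapOf (algebraMap k L)) ∧
      (∀ x₀ x₁ : Spec (CommRingCat.of L) ⟶ X,
        x₀ ≫ sX = specMapOf (algebraMap k L) → x₁ ≫ sX = specMapOf (algebraMap k L) →
        A1Equiv k L (algebraMap k L) X sX x₀ x₁) := by
  intro L _ _
  have hpt' (i j) : ∃ p : Spec (CommRingCat.of L) ⟶ X, p ≫ sX = specMapOf (algebraMap k L) ∧
      Set.range p ⊆ (U i ⊓ U j : X.Opens) := by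
    obtain ⟨p, hp⟩ := hpt i j
    refine ⟨specMapOf (algebraMap k L) ≫ p ≫ (U i ⊓ U j : X.Opens).ι, ?_, ?_⟩
    · rw [Category.assoc, Category.assoc, hp, ← specMapOf_comp, RingHom.comp_id]
    · rintro _ ⟨y, rfl⟩
      exact ((specMapOf (algebraMap k L) ≫ p) y).2
  refine ⟨?_, fun x₀ x₁ h₀ h₁ ↦ ?_⟩
  · obtain ⟨p, hp, -⟩ := hpt' ⟨0, hr⟩ ⟨0, hr⟩
    exact ⟨p, hp⟩
  · obtain ⟨i, hi⟩ := exists_range_subset_of_iSup_eq_top hcover x₀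
    obtain ⟨j, hj⟩ := exists_range_subset_of_iSup_eq_top hcover x₁
    obtain ⟨p, hp, hpU⟩ := hpt' i j
    obtain ⟨e, he⟩ := haff i
    obtain ⟨e', he'⟩ := haff j
    exact .trans _ p _
      (.rel _ _ (elemA1Equiv_of_opens e he h₀ hp hi fun _ h ↦ (hpU h).1))
      (.rel _ _ (elemA1Equiv_of_opens e' he' hp h₁ (fun _ h ↦ (hpU h).2) hj))

end
end

section
/- Let k be a field and let X and Y be integral separated schemes of finite type over k. Suppose there exist a nonempty open subscheme U ⊆ X ×_k Y, an open subscheme W ⊆ 𝔸^N_k for some N, an isomorphism of k-schemes U ≅ W, and a k-point u : Spec k → U. Then X is retract k-rational: there exist a nonempty open subscheme X₁ ⊆ X, an open subscheme V ⊆ 𝔸^N_k, and k-morphisms f : X₁ → V and g : V → X₁ with g ∘ f = id_{X₁}. -/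
open AlgebraicGeometry CategoryTheory CategoryTheory.Limits

noncomputable section

/-- Affine `N`-space over `k`, i.e. `Spec k[T₁, …, T_N]`. -/
abbrev AffSpace (k : Type) [Field k] (N : ℕ) : Scheme :=
  Spec (CommRingCat.of (MvPolynomial (Fin N) k))

/-- The structure morphism of affine `N`-space over `k`. -/
def affSpaceStruct (k : Type) [Field k] (N : ℕ) :
    AffSpace k N ⟶ Spec (CommRingCat.of k) :=
  specMapOf (MvPolynomial.C : k →+* MvPolynomial (Fin N) k)

/-- A morphism whose image lies in an open subscheme factors through that open subscheme. -/
theorem exists_lift_opens {X Z : Scheme} (O : X.Opens) (f : Z ⟶ X) (h : ∀ z, f z ∈ O) :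
    ∃ g : Z ⟶ O.toScheme, g ≫ O.ι = f := by
  have hr : Set.range f ⊆ Set.range O.ι := by
    rintro _ ⟨z, rfl⟩
    simpa using h z
  exact ⟨IsOpenImmersion.lift O.ι f hr, IsOpenImmersion.lift_fac _ _ _⟩

/-- If an open immersion `X₁ ⟶ X` factors through a morphism `p : W ⟶ X` from an open subscheme
`W` of `A`, then `X₁` is a retract of an open subscheme of `A`, compatibly with structure
morphisms to a base. -/
theorem exists_retract_of_section {A X S : Scheme} (sA : A ⟶ S) (sX : X ⟶ S)
    (W : A.Opens) (p : W.toScheme ⟶ X) (hp : p ≫ sX = W.ι ≫ sA)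
    (X₁ : X.Opens) (b : X₁.toScheme ⟶ W.toScheme) (hb : b ≫ p = X₁.ι) :
    ∃ (V : A.Opens) (f : X₁.toScheme ⟶ V.toScheme) (g : V.toScheme ⟶ X₁.toScheme),
      f ≫ V.ι ≫ sA = X₁.ι ≫ sX ∧ g ≫ X₁.ι ≫ sX = V.ι ≫ sA ∧ f ≫ g = 𝟙 X₁.toScheme := by
  have hV : ∀ v : ↥(W.ι ''ᵁ p ⁻¹ᵁ X₁).toScheme, ∃ w : ↥W.toScheme,
      p w ∈ X₁ ∧ W.ι w = (W.ι ''ᵁ p ⁻¹ᵁ X₁).ι v := fun v ↦ v.2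
  obtain ⟨q, hq⟩ := exists_lift_opens W (W.ι ''ᵁ p ⁻¹ᵁ X₁).ι fun v ↦ by
    obtain ⟨w, -, hw⟩ := hV v
    exact hw ▸ w.2
  obtain ⟨g, hg⟩ := exists_lift_opens X₁ (q ≫ p) fun v ↦ by
    obtain ⟨w, hwX, hw⟩ := hV v
    have hqv : q v = w := W.ι.isOpenEmbedding.injective <| by
      rw [hw, ← hq, Scheme.Hom.comp_apply]
    rw [Scheme.Hom.comp_apply, hqv]
    exact hwX
  obtain ⟨f, hf⟩ := exists_lift_opens (W.ι ''ᵁ p ⁻¹ᵁ X₁) (b ≫ W.ι) fun x ↦ by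
    refine ⟨b x, ?_, (Scheme.Hom.comp_apply b W.ι x).symm⟩
    change p (b x) ∈ X₁
    rw [← Scheme.Hom.comp_apply, hb]
    exact x.2
  have hfq : f ≫ q = b := by
    rw [← cancel_mono W.ι, Category.assoc, hq, hf]
  refine ⟨_, f, g, ?_, ?_, ?_⟩
  · rw [reassoc_of% hf, ← hp, reassoc_of% hb]
  · rw [reassoc_of% hg, hp, reassoc_of% hq]
  · rw [← cancel_mono X₁.ι, Category.assoc, hg, reassoc_of% hfq, hb, Category.id_comp]

/-- If `X` and `Y` are integral separated finite-type `k`-schemes such that some nonempty open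
subscheme `U` of `X ×ₖ Y` is isomorphic over `k` to an open subscheme `W` of affine `N`-space
and `U` has a `k`-point, then `X` is retract `k`-rational: there are a nonempty open `X₁ ⊆ X`,
an open `V ⊆ 𝔸^N_k` and `k`-morphisms `f : X₁ ⟶ V`, `g : V ⟶ X₁` with `g ∘ f = id`. -/
theorem factorRational_retractRational
    (k : Type) [Field k] (N : ℕ)
    (X Y : Scheme) (sX : X ⟶ Spec (CommRingCat.of k)) (sY : Y ⟶ Spec (CommRingCat.of k))
    (hXint : IsIntegral X) (hYint : IsIntegral Y)
    (hXsep : IsSeparated sX) (hXlft : LocallyOfFiniteType sX) (hXqc : QuasiCompact sX)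
    (hYsep : IsSeparated sY) (hYlft : LocallyOfFiniteType sY) (hYqc : QuasiCompact sY)
    (U : (pullback sX sY).Opens) (hU : U ≠ ⊥)
    (W : (AffSpace k N).Opens)
    (e : U.toScheme ≅ W.toScheme)
    (he : e.hom ≫ W.ι ≫ affSpaceStruct k N = U.ι ≫ pullback.fst sX sY ≫ sX)
    (u : Spec (CommRingCat.of k) ⟶ U.toScheme)
    (hu : u ≫ U.ι ≫ pullback.fst sX sY ≫ sX = specMapOf (RingHom.id k)) :
    ∃ (X₁ : X.Opens) (_ : X₁ ≠ ⊥) (V : (AffSpace k N).Opens)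
      (f : X₁.toScheme ⟶ V.toScheme) (g : V.toScheme ⟶ X₁.toScheme),
      f ≫ V.ι ≫ affSpaceStruct k N = X₁.ι ≫ sX ∧
      g ≫ X₁.ι ≫ sX = V.ι ≫ affSpaceStruct k N ∧
      f ≫ g = 𝟙 X₁.toScheme := by
  have hu' : u ≫ U.ι ≫ pullback.fst sX sY ≫ sX = 𝟙 _ := hu.trans (Spec.map_id _)
  have hy : (u ≫ U.ι ≫ pullback.snd sX sY) ≫ sY = 𝟙 _ := by
    rw [Category.assoc, Category.assoc, ← pullback.condition, hu']
  let σ : X ⟶ pullback sX sY :=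
    pullback.lift (𝟙 X) (sX ≫ u ≫ U.ι ≫ pullback.snd sX sY) (by
      rw [Category.assoc, hy, Category.id_comp, Category.comp_id])
  have hσ : σ ≫ pullback.fst sX sY = 𝟙 X := pullback.lift_fst _ _ _
  have hσ' : σ ≫ pullback.snd sX sY = sX ≫ u ≫ U.ι ≫ pullback.snd sX sY :=
    pullback.lift_snd _ _ _
  have hσu : (u ≫ U.ι ≫ pullback.fst sX sY) ≫ σ = u ≫ U.ι := by
    apply pullback.hom_ext
    · simp [hσ]
    · have h := congrArg (· ≫ u ≫ U.ι ≫ pullback.snd sX sY) hu'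
      simpa [hσ'] using h
  obtain ⟨a, ha⟩ := exists_lift_opens U ((σ ⁻¹ᵁ U).ι ≫ σ) fun x ↦ by
    rw [Scheme.Hom.comp_apply]
    exact x.2
  refine ⟨σ ⁻¹ᵁ U, ?_, exists_retract_of_section (affSpaceStruct k N) sX W
    (e.inv ≫ U.ι ≫ pullback.fst sX sY) ?_ _ (a ≫ e.hom) ?_⟩
  · obtain ⟨t⟩ : Nonempty ↥(Spec (CommRingCat.of k)) := inferInstance
    have hmem : (u ≫ U.ι ≫ pullback.fst sX sY) t ∈ σ ⁻¹ᵁ U := by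
      change σ ((u ≫ U.ι ≫ pullback.fst sX sY) t) ∈ U
      rw [← Scheme.Hom.comp_apply, hσu, Scheme.Hom.comp_apply]
      exact (u t).2
    intro h
    rw [h] at hmem
    exact hmem
  · rw [Category.assoc, Category.assoc, ← he, Iso.inv_hom_id_assoc]
  · rw [Category.assoc, Iso.hom_inv_id_assoc, reassoc_of% ha, hσ, Category.comp_id]

end
end

section
/- Let k be a field, let X be a proper scheme of finite type over k, and let L be a field extension of k. Then every k-morphism ξ : Spec L(t) → X extends to the affine line over L: there exists a k-morphism H : 𝔸¹_L → X with H ∘ η = ξ, where η : Spec L(t) → 𝔸¹_L is the canonical morphism induced by the inclusion L[T] ⊆ L(t). Equivalently, the natural map X(𝔸¹_L) → X(L(t)) is surjective. -/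
open AlgebraicGeometry CategoryTheory CategoryTheory.Limits

noncomputable section

/-- The localization of a Bézout domain at a prime ideal is a valuation ring. -/
theorem IsLocalization.AtPrime.valuationRing_of_isBezout {R A : Type*} [CommRing R] [IsDomain R]
    [IsBezout R] [CommRing A] [IsDomain A] [Algebra R A] (P : Ideal R) [P.IsPrime]
    [IsLocalization.AtPrime A P] : ValuationRing A := by
  rw [ValuationRing.iff_dvd_total]
  refine ⟨fun a b ↦ ?_⟩
  obtain ⟨⟨a', s⟩, ha⟩ := IsLocalization.surj P.primeCompl a
  obtain ⟨⟨b', t⟩, hb⟩ := IsLocalization.surj P.primeCompl b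
  have hs := IsLocalization.map_units A s
  have ht := IsLocalization.map_units A t
  simp only at ha hb
  have hsa : Associated a (algebraMap R A a') := ha ▸ (associated_mul_unit_right a _ hs)
  have htb : Associated b (algebraMap R A b') := hb ▸ (associated_mul_unit_right b _ ht)
  rw [hsa.dvd_iff_dvd_left, hsa.dvd_iff_dvd_right, htb.dvd_iff_dvd_left, htb.dvd_iff_dvd_right]
  obtain ⟨x, y, hxy⟩ := IsBezout.gcd_eq_sum a' b'
  obtain ⟨c, hc⟩ := IsBezout.gcd_dvd_left a' b'
  obtain ⟨d, hd⟩ := IsBezout.gcd_dvd_right a' b'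
  set g := IsBezout.gcd a' b'
  obtain hg | hg := eq_or_ne g 0
  · simp [hc, hd, hg]
  have h1 : x * c + y * d = 1 := mul_left_cancel₀ hg (by linear_combination hxy - x * hc - y * hd)
  by_cases hcP : c ∈ P
  · have hdP : d ∉ P := fun hdP ↦ (Ideal.ne_top_iff_one P).mp (Ideal.IsPrime.ne_top ‹_›)
      (h1 ▸ P.add_mem (P.mul_mem_left x hcP) (P.mul_mem_left y hdP))
    have hu : IsUnit (algebraMap R A d) := IsLocalization.map_units A ⟨d, hdP⟩ (M := P.primeCompl)
    right
    rw [hd, map_mul, hu.mul_right_dvd, hc, map_mul]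
    exact dvd_mul_right _ _
  · have hu : IsUnit (algebraMap R A c) := IsLocalization.map_units A ⟨c, hcP⟩ (M := P.primeCompl)
    left
    rw [hc, map_mul, hu.mul_right_dvd, hd, map_mul]
    exact dvd_mul_right _ _

namespace AlgebraicGeometry
universe u
open Scheme

/-- The existence part of the valuative criterion, for a ring homomorphism `σ : R ⟶ K`
identifying the field `K` with the fraction field of the valuation ring `R`. -/
theorem exists_lift_of_isFractionRing {X S : Scheme.{u}} (f : X ⟶ S) [UniversallyClosed f]
    {R K : CommRingCat.{u}} [IsDomain R] [ValuationRing R] (σ : R ⟶ K) (hK : IsField K)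
    (hσ : letI := σ.hom.toAlgebra; IsFractionRing R K) (i₁ : Spec K ⟶ X) (i₂ : Spec R ⟶ S)
    (w : i₁ ≫ f = Spec.map σ ≫ i₂) :
    ∃ ψ : Spec R ⟶ X, Spec.map σ ≫ ψ = i₁ ∧ ψ ≫ f = i₂ := by
  have h : ValuativeCriterion.Existence f :=
    (UniversallyClosed.eq_valuativeCriterion.le _ _ f ‹_›).1
  let := hK.toField
  let : Algebra R K := σ.hom.toAlgebra
  let sq : ValuativeCommSq f :=
    { R := R, K := K, isFractionRing := hσ, i₁ := i₁, i₂ := i₂, commSq := ⟨w⟩ }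
  obtain ⟨⟨ψ, hψ₁, hψ₂⟩⟩ := (h sq).exists_lift
  exact ⟨ψ, hψ₁, hψ₂⟩

/-- A morphism from the generic point of an integral scheme whose local rings are valuation rings
to a proper scheme extends to the whole scheme. -/
theorem exists_fromSpecStalk_genericPoint_comp_eq_of_isProper {C X S : Scheme.{u}} [IsIntegral C]
    [S.IsSeparated] (hC : ∀ x : C, ValuationRing (C.presheaf.stalk x))
    (sC : C ⟶ S) (sX : X ⟶ S) [IsProper sX] (φ : Spec C.functionField ⟶ X)
    (hφ : φ ≫ sX = C.fromSpecStalk _ ≫ sC) :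
    ∃ H : C ⟶ X, H ≫ sX = sC ∧ C.fromSpecStalk _ ≫ H = φ := by
  have : X.IsSeparated := by
    constructor
    rw [← terminal.comp_from sX]
    infer_instance
  let f : C.RationalMap X := .ofFunctionField sC sX φ hφ
  have hf : f.fromFunctionField = φ := RationalMap.fromFunctionField_ofFunctionField sC sX φ hφ
  have hdom : f.domain = ⊤ := by
    refine top_unique fun x _ ↦ RationalMap.mem_domain.mpr ?_
    have := hC x
    let sp := C.presheaf.stalkSpecializes ((genericPoint_spec C).specializes (Set.mem_univ x))
    have hsp : Spec.map sp ≫ C.fromSpecStalk x = C.fromSpecStalk _ :=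
      C.SpecMap_stalkSpecializes_fromSpecStalk _
    obtain ⟨ψ, hψ₁, hψ₂⟩ := exists_lift_of_isFractionRing sX sp (Field.toIsField C.functionField)
      (inferInstanceAs (IsFractionRing (C.presheaf.stalk x) C.functionField)) φ
      (C.fromSpecStalk x ≫ sC) (by rw [hφ, ← hsp, Category.assoc])
    let g := PartialMap.ofFromSpecStalk sC sX ψ hψ₂
    refine ⟨g, PartialMap.mem_domain_ofFromSpecStalk sC sX ψ hψ₂,
      RationalMap.eq_of_fromFunctionField_eq _ _ ?_⟩
    rw [hf, RationalMap.fromFunctionField_toRationalMap, ← hψ₁,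
      ← PartialMap.fromSpecStalkOfMem_ofFromSpecStalk sC sX ψ hψ₂]
    simp only [PartialMap.fromSpecStalkOfMem, ← Category.assoc]
    congr 1
    rw [← cancel_mono (Opens.ι _)]
    simp only [Category.assoc, Opens.fromSpecStalkOfMem_ι]
    rw [Opens.fromSpecStalkOfMem_ι]
    exact hsp.symm
  let p := f.toPartialMap
  have hp : p.domain = ⊤ := hdom
  let H : C ⟶ X := C.topIso.inv ≫ (C.isoOfEq hp).inv ≫ p.hom
  have hH : H.toPartialMap = p := by
    refine PartialMap.ext _ _ hp.symm ?_
    simp [H]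
    rfl
  have hHφ : C.fromSpecStalk _ ≫ H = φ := by
    rw [← PartialMap.fromSpecStalkOfMem_toPartialMap, ← hf, ← f.toRationalMap_toPartialMap]
    change _ = p.toRationalMap.fromFunctionField
    rw [← hH]
    rfl
  refine ⟨H, ?_, hHφ⟩
  have : IsDominant (C.fromSpecStalk (genericPoint C)) := by
    refine ⟨dense_iff_closure_eq.mpr (Set.univ_subset_iff.mp ?_)⟩
    rw [← (genericPoint_spec C).def]
    exact closure_mono (Set.singleton_subset_iff.mpr ⟨_, C.fromSpecStalk_closedPoint⟩)
  refine ext_of_isDominant (C.fromSpecStalk (genericPoint C)) ?_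
  rw [← Category.assoc, hHφ, hφ]

/-- The local rings of the spectrum of a Bézout domain are valuation rings. -/
theorem Spec.valuationRing_stalk {R : CommRingCat.{u}} [IsDomain R] [IsBezout R] (x : Spec R) :
    ValuationRing ((Spec R).presheaf.stalk x) := by
  let : Algebra R ((Spec R).presheaf.stalk x) := (StructureSheaf.toStalk R x).hom.toAlgebra
  have : IsLocalization.AtPrime ((Spec R).presheaf.stalk x) x.asIdeal (hp := x.isPrime) :=
    StructureSheaf.IsLocalization.to_stalk R x
  have := x.isPrime
  exact IsLocalization.AtPrime.valuationRing_of_isBezout x.asIdeal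

/-- The valuative criterion for properness with the valuation ring replaced by a Bézout domain. -/
theorem exists_specMap_comp_eq_of_isProper {R K : CommRingCat.{u}} [IsDomain R] [IsBezout R]
    (σ : R ⟶ K) (hσ : letI := σ.hom.toAlgebra; IsFractionRing R K)
    {X S : Scheme.{u}} [S.IsSeparated] (sC : Spec R ⟶ S) (sX : X ⟶ S) [IsProper sX]
    (ξ : Spec K ⟶ X) (hξ : ξ ≫ sX = Spec.map σ ≫ sC) :
    ∃ H : Spec R ⟶ X, H ≫ sX = sC ∧ Spec.map σ ≫ H = ξ := by
  let : Algebra R K := σ.hom.toAlgebra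
  let e : K ≃ₐ[R] (Spec R).functionField := IsLocalization.algEquiv (nonZeroDivisors R) _ _
  let i : K ≅ (Spec R).functionField := e.toRingEquiv.toCommRingCatIso
  have hi : Spec.map i.hom ≫ Spec.map σ = (Spec R).fromSpecStalk (genericPoint (Spec R)) := by
    rw [← Spec.map_comp, Spec.fromSpecStalk_eq']
    congr 1
    ext r
    exact e.commutes r
  obtain ⟨H, hH, hHφ⟩ := exists_fromSpecStalk_genericPoint_comp_eq_of_isProper
    Spec.valuationRing_stalk sC sX (Spec.map i.hom ≫ ξ) (by
      rw [Category.assoc, hξ, ← Category.assoc, hi])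
  refine ⟨H, hH, ?_⟩
  rw [← cancel_epi (Spec.map i.hom), ← Category.assoc, hi, hHφ]

end AlgebraicGeometry

/-- If `X` is a proper `k`-scheme and `L` is a field extension of `k`, then every `k`-morphism
`ξ : Spec L(t) ⟶ X` extends to the affine line over `L`: there is a `k`-morphism
`H : 𝔸¹_L = Spec L[T] ⟶ X` with `H ∘ η = ξ`, where `η : Spec L(t) ⟶ 𝔸¹_L` is induced by the
inclusion `L[T] ⊆ L(t)`.  Equivalently, `X(𝔸¹_L) → X(L(t))` is surjective. -/
theorem ratFuncPoint_extends_to_affineLine_of_proper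
    (k : Type) [Field k]
    (X : Scheme) (sX : X ⟶ Spec (CommRingCat.of k)) (hX : IsProper sX)
    (L : Type) [Field L] [Algebra k L]
    (ξ : Spec (CommRingCat.of (RatFunc L)) ⟶ X)
    (hξ : ξ ≫ sX = specMapOf ((algebraMap (Polynomial L) (RatFunc L)).comp
      ((Polynomial.C : L →+* Polynomial L).comp (algebraMap k L)))) :
    ∃ H : Spec (CommRingCat.of (Polynomial L)) ⟶ X,
      H ≫ sX = specMapOf ((Polynomial.C : L →+* Polynomial L).comp (algebraMap k L)) ∧
      specMapOf (algebraMap (Polynomial L) (RatFunc L)) ≫ H = ξ := by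
  refine exists_specMap_comp_eq_of_isProper
    (CommRingCat.ofHom (algebraMap (Polynomial L) (RatFunc L))) ?_ _ sX ξ ?_
  · have h : (algebraMap (Polynomial L) (RatFunc L)).toAlgebra =
        (inferInstance : Algebra (Polynomial L) (RatFunc L)) :=
      Algebra.algebra_ext _ _ fun _ ↦ rfl
    change @IsFractionRing (Polynomial L) _ (RatFunc L) _
      (algebraMap (Polynomial L) (RatFunc L)).toAlgebra
    rw [h]
    infer_instance
  · rw [hξ, specMapOf, specMapOf, ← Spec.map_comp]
    rfl

end
end

section
/- Let n ≥ 1 be an integer and let d, d' be integers with d ≡ d' (mod n+1). Then there is a ring isomorphism between R_{n,d} := ℤ[σ,ξ]/(σ², ξ^{n+1} + d·ξⁿσ) and R_{n,d'} := ℤ[σ,ξ]/(σ², ξ^{n+1} + d'·ξⁿσ) which maps the additive subgroup of R_{n,d} generated by the residue classes of σ and ξ onto the additive subgroup of R_{n,d'} generated by the residue classes of σ and ξ (i.e., the two rings are isomorphic as graded rings, for the grading in which σ and ξ are homogeneous of degree 1). In particular, the substitution σ ↦ σ, ξ ↦ ξ + σ induces such an isomorphism from R_{n,d-(n+1)} to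 R_{n,d}. -/
open MvPolynomial

noncomputable section

/-- The ideal `(σ², ξ^{n+1} + d·ξⁿσ)` of `ℤ[σ,ξ]`, where `σ = X 0` and `ξ = X 1`. -/
def chowIdeal (n : ℕ) (d : ℤ) : Ideal (MvPolynomial (Fin 2) ℤ) :=
  Ideal.span {(X 0 : MvPolynomial (Fin 2) ℤ) ^ 2,
    (X 1 : MvPolynomial (Fin 2) ℤ) ^ (n + 1) + C d * (X 1) ^ n * (X 0)}

/-- The ring `R_{n,d} = ℤ[σ,ξ]/(σ², ξ^{n+1} + d·ξⁿσ)`, the Chow ring of the projectivization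
of a rank `n+1` vector bundle of degree `d` over the projective line. -/
def ChowRing (n : ℕ) (d : ℤ) : Type :=
  MvPolynomial (Fin 2) ℤ ⧸ chowIdeal n d

instance (n : ℕ) (d : ℤ) : CommRing (ChowRing n d) :=
  inferInstanceAs (CommRing (MvPolynomial (Fin 2) ℤ ⧸ chowIdeal n d))

/-- The degree-one part of `R_{n,d}`: the additive subgroup generated by the residue classes
of `σ` and `ξ`. -/
def chowDegOne (n : ℕ) (d : ℤ) : AddSubgroup (ChowRing n d) :=
  AddSubgroup.closure
    {Ideal.Quotient.mk (chowIdeal n d) (X 0), Ideal.Quotient.mk (chowIdeal n d) (X 1)}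

/-- The defining quotient map `ℤ[σ,ξ] → R_{n,d}`. -/
def chowMk (n : ℕ) (d : ℤ) : MvPolynomial (Fin 2) ℤ →+* ChowRing n d :=
  Ideal.Quotient.mk (chowIdeal n d)

theorem chowMk_surjective (n : ℕ) (d : ℤ) : Function.Surjective (chowMk n d) :=
  Ideal.Quotient.mk_surjective

theorem chowDegOne_eq_closure (n : ℕ) (d : ℤ) :
    chowDegOne n d = AddSubgroup.closure {chowMk n d (X 0), chowMk n d (X 1)} :=
  rfl

theorem chowMk_X_zero_sq (n : ℕ) (d : ℤ) : chowMk n d (X 0) ^ 2 = 0 := by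
  rw [← map_pow]
  exact Ideal.Quotient.eq_zero_iff_mem.mpr (Ideal.subset_span (Or.inl rfl))

theorem chowMk_relation (n : ℕ) (d : ℤ) :
    chowMk n d (X 1) ^ (n + 1) + d * chowMk n d (X 1) ^ n * chowMk n d (X 0) = 0 := by
  have h : chowMk n d (X 1 ^ (n + 1) + C d * X 1 ^ n * X 0) = 0 :=
    Ideal.Quotient.eq_zero_iff_mem.mpr (Ideal.subset_span (Or.inr rfl))
  simpa using h

/-- The universal property of `R_{n,d}`: elements `s`, `x` of a commutative ring satisfying the
defining relations determine a ring homomorphism with `σ ↦ s` and `ξ ↦ x`. -/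
def chowLift {A : Type*} [CommRing A] (n : ℕ) (d : ℤ) (s x : A) (hs : s ^ 2 = 0)
    (hx : x ^ (n + 1) + d * x ^ n * s = 0) : ChowRing n d →+* A :=
  Ideal.Quotient.lift (chowIdeal n d) (eval₂Hom (Int.castRingHom A) ![s, x]) <| by
    intro a ha
    rw [← RingHom.mem_ker]
    refine Ideal.span_le.mpr ?_ ha
    rintro _ (rfl | rfl)
    · simp [RingHom.mem_ker, hs]
    · simpa [RingHom.mem_ker, -coe_eval₂Hom, eval₂Hom_X'] using hx

theorem chowLift_chowMk {A : Type*} [CommRing A] (n : ℕ) (d : ℤ) (s x : A) (hs : s ^ 2 = 0)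
    (hx : x ^ (n + 1) + d * x ^ n * s = 0) (p : MvPolynomial (Fin 2) ℤ) :
    chowLift n d s x hs hx (chowMk n d p) = eval₂Hom (Int.castRingHom A) ![s, x] p :=
  rfl

theorem ChowRing.hom_ext {A : Type*} [CommRing A] {n : ℕ} {d : ℤ} {f g : ChowRing n d →+* A}
    (h₀ : f (chowMk n d (X 0)) = g (chowMk n d (X 0)))
    (h₁ : f (chowMk n d (X 1)) = g (chowMk n d (X 1))) : f = g := by
  rw [← RingHom.cancel_right (chowMk_surjective n d)]
  refine MvPolynomial.ringHom_ext (fun r => by simp) fun i => ?_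
  fin_cases i
  · exact h₀
  · exact h₁

theorem add_pow_mul_of_sq_eq_zero {A : Type*} [CommRing A] (x s t : A) (hst : s * t = 0) (m : ℕ) :
    (x + s) ^ m * t = x ^ m * t := by
  induction m with
  | zero => simp
  | succ m ih => linear_combination (x + s) * ih + x ^ m * hst

theorem add_pow_succ_of_sq_eq_zero {A : Type*} [CommRing A] (x s : A) (hs : s ^ 2 = 0) (m : ℕ) :
    (x + s) ^ (m + 1) = x ^ (m + 1) + (m + 1) * x ^ m * s := by
  induction m with
  | zero => simp
  | succ m ih =>
    push_cast
    linear_combination (x + s) * ih + (m + 1) * x ^ m * hs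

/-- The substitution `σ ↦ σ`, `ξ ↦ ξ + kσ` as a homomorphism `R_{n,d} → R_{n,e}`, where
`e = d + (n+1)k`. -/
def chowShift (n : ℕ) (d e k : ℤ) (h : e = d + (n + 1) * k) : ChowRing n d →+* ChowRing n e :=
  chowLift n d (chowMk n e (X 0)) (chowMk n e (X 1) + k * chowMk n e (X 0))
    (chowMk_X_zero_sq n e) <| by
      have hs := chowMk_X_zero_sq n e
      have hx := chowMk_relation n e
      generalize chowMk n e (X 0) = s at *
      generalize chowMk n e (X 1) = x at *
      have he : (e : ChowRing n e) = d + (n + 1) * k :=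
        (congrArg (Int.cast : ℤ → ChowRing n e) h).trans (by push_cast; rfl)
      rw [mul_assoc, add_pow_mul_of_sq_eq_zero x (k * s) s (by linear_combination k * hs),
        add_pow_succ_of_sq_eq_zero x (k * s) (by linear_combination k ^ 2 * hs)]
      linear_combination hx - x ^ n * s * he

theorem chowShift_X_zero (n : ℕ) (d e k : ℤ) (h : e = d + (n + 1) * k) :
    chowShift n d e k h (chowMk n d (X 0)) = chowMk n e (X 0) := by
  simp [chowShift, chowLift_chowMk]

theorem chowShift_X_one (n : ℕ) (d e k : ℤ) (h : e = d + (n + 1) * k) :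
    chowShift n d e k h (chowMk n d (X 1)) = chowMk n e (X 1) + k * chowMk n e (X 0) := by
  simp [chowShift, chowLift_chowMk]

theorem chowShift_comp_chowShift_neg (n : ℕ) (d e k l : ℤ) (h : e = d + (n + 1) * k)
    (h' : d = e + (n + 1) * l) (hkl : k + l = 0) :
    (chowShift n e d l h').comp (chowShift n d e k h) = RingHom.id _ := by
  obtain rfl : l = -k := by omega
  apply ChowRing.hom_ext <;> simp [chowShift_X_zero, chowShift_X_one]

theorem chowShift_mem_chowDegOne (n : ℕ) (d e k : ℤ) (h : e = d + (n + 1) * k)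
    {x : ChowRing n d} (hx : x ∈ chowDegOne n d) : chowShift n d e k h x ∈ chowDegOne n e := by
  rw [chowDegOne_eq_closure] at hx ⊢
  have h₀ := AddSubgroup.subset_closure
    (Set.mem_insert (chowMk n e (X 0)) {chowMk n e (X 1)})
  have h₁ := AddSubgroup.subset_closure
    (Set.mem_insert_of_mem (chowMk n e (X 0)) (Set.mem_singleton (chowMk n e (X 1))))
  induction hx using AddSubgroup.closure_induction with
  | mem x hx =>
    rcases hx with rfl | rfl
    · rwa [chowShift_X_zero]
    · rw [chowShift_X_one, ← zsmul_eq_mul]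
      exact add_mem h₁ (zsmul_mem h₀ k)
  | zero => rw [map_zero]; exact zero_mem _
  | add x y _ _ hx hy => rw [map_add]; exact add_mem hx hy
  | neg x _ hx => rw [map_neg]; exact neg_mem hx

/-- The isomorphism `R_{n,d} ≃ R_{n,e}` given by `σ ↦ σ`, `ξ ↦ ξ + kσ`, where
`e = d + (n+1)k`. -/
def chowShiftEquiv (n : ℕ) (d e k : ℤ) (h : e = d + (n + 1) * k) : ChowRing n d ≃+* ChowRing n e :=
  RingEquiv.ofRingHom (chowShift n d e k h) (chowShift n e d (-k) (by rw [h]; ring))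
    (chowShift_comp_chowShift_neg _ _ _ _ _ _ _ (neg_add_cancel k))
    (chowShift_comp_chowShift_neg _ _ _ _ _ _ _ (add_neg_cancel k))

/-- If `d ≡ d' (mod n+1)` then `R_{n,d}` and `R_{n,d'}` are isomorphic as graded rings: there
is a ring isomorphism carrying the additive subgroup generated by the classes of `σ` and `ξ`
onto the corresponding subgroup.  (Such an isomorphism is induced by the substitution
`σ ↦ σ`, `ξ ↦ ξ + σ`, iterated.) -/
theorem chowRing_iso_of_modEq (n : ℕ) (hn : 1 ≤ n) (d d' : ℤ)
    (h : d ≡ d' [ZMOD (n + 1 : ℕ)]) :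
    ∃ φ : ChowRing n d ≃+* ChowRing n d',
      ∀ x : ChowRing n d, x ∈ chowDegOne n d ↔ φ x ∈ chowDegOne n d' := by
  obtain ⟨k, hk⟩ := h.dvd
  have hd : d' = d + (n + 1) * k := by push_cast at hk; linarith
  refine ⟨chowShiftEquiv n d d' k hd, fun x =>
    ⟨chowShift_mem_chowDegOne n d d' k hd, fun hx => ?_⟩⟩
  rw [← (chowShiftEquiv n d d' k hd).symm_apply_apply x]
  exact chowShift_mem_chowDegOne n d' d (-k) (by rw [hd]; ring) hx

end
end

section
/- Let k be a field and let 𝔾ₘ = Spec k[T, T⁻¹] be the multiplicative group scheme over k. For every reduced k-scheme U, the map Hom_k(U, 𝔾ₘ) → Hom_k(U ×_k 𝔸¹_k, 𝔾ₘ) induced by precomposition with the projection U ×_k 𝔸¹_k → U is a bijection. In particular, 𝔾ₘ is A¹-rigid. -/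
open AlgebraicGeometry CategoryTheory CategoryTheory.Limits

noncomputable section

/-- The structure morphism of the affine line `𝔸¹_k = Spec k[T]` over `k`. -/
def a1Struct (k : Type) [Field k] :
    Spec (CommRingCat.of (Polynomial k)) ⟶ Spec (CommRingCat.of k) :=
  specMapOf (Polynomial.C : k →+* Polynomial k)

/-- The multiplicative group scheme `𝔾ₘ = Spec k[T, T⁻¹]` over `k`, i.e. the spectrum of the
localization of `k[T]` at `T`. -/
abbrev Gm (k : Type) [Field k] : Scheme :=
  Spec (CommRingCat.of (Localization.Away (Polynomial.X : Polynomial k)))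

/-- The structure morphism of `𝔾ₘ` over `k`. -/
def gmStruct (k : Type) [Field k] : Gm k ⟶ Spec (CommRingCat.of k) :=
  specMapOf ((algebraMap (Polynomial k)
    (Localization.Away (Polynomial.X : Polynomial k))).comp
      (Polynomial.C : k →+* Polynomial k))

namespace Polynomial

/-- A unit of the polynomial ring over a reduced ring is constant. -/
theorem C_eval_zero_of_isUnit {A : Type*} [CommRing A] [IsReduced A] {p : Polynomial A}
    (hp : IsUnit p) : C (p.eval 0) = p := by
  have h := eq_C_of_natDegree_eq_zero
    (Nat.eq_zero_of_not_pos fun hd => not_isUnit_of_natDegree_pos_of_isReduced p hd hp)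
  rw [← coeff_zero_eq_eval_zero]
  exact h.symm

/-- Evaluation at zero followed by the inclusion of constants fixes every `k`-algebra homomorphism
`k[T, T⁻¹] → A[T]` when `A` is reduced. -/
theorem C_comp_eval_zero_comp_eq {k A : Type*} [CommRing k] [CommRing A] [IsReduced A]
    (β : k →+* A) (φ : Localization.Away (X : Polynomial k) →+* Polynomial A)
    (hφ : φ.comp ((algebraMap (Polynomial k) _).comp C) = C.comp β) :
    (C.comp (evalRingHom 0)).comp φ = φ := by
  refine IsLocalization.ringHom_ext (Submonoid.powers (X : Polynomial k)) ?_
  refine ringHom_ext (fun a => ?_) ?_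
  · have h : φ (algebraMap (Polynomial k) _ (C a)) = C (β a) := RingHom.congr_fun hφ a
    simp [h]
  · exact C_eval_zero_of_isUnit
      ((IsLocalization.Away.algebraMap_isUnit (X : Polynomial k)).map φ)

end Polynomial

section AffineLine

variable {k : Type} [Field k]

/-- The affine line over an affine `k`-scheme `Spec A` is `Spec A[T]`. -/
theorem isPullback_a1Struct {A : CommRingCat.{0}} (β : CommRingCat.of k ⟶ A) :
    IsPullback (Spec.map (CommRingCat.ofHom (Polynomial.C : A →+* Polynomial A)))
      (specMapOf (Polynomial.mapRingHom β.hom)) (Spec.map β) (a1Struct k) := by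
  algebraize [β.hom]
  let : Algebra (Polynomial k) (Polynomial A) := Polynomial.algebra k A
  exact isPullback_SpecMap_of_isPushout _ _ _ _
    (CommRingCat.isPushout_of_isPushout k A (Polynomial k) (Polynomial A))

/-- The zero section of the affine line over `k`. -/
def a1Zero (k : Type) [Field k] :
    Spec (CommRingCat.of k) ⟶ Spec (CommRingCat.of (Polynomial k)) :=
  specMapOf (Polynomial.evalRingHom 0)

@[simp]
theorem a1Zero_a1Struct : a1Zero k ≫ a1Struct k = 𝟙 _ := by
  rw [a1Zero, a1Struct, specMapOf, specMapOf, ← Spec.map_comp, ← Spec.map_id]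
  congr 1
  ext x
  simp

/-- The zero section of `U ×ₖ 𝔸¹_k ⟶ U`. -/
def zeroSection {U : Scheme.{0}} (sU : U ⟶ Spec (CommRingCat.of k)) :
    U ⟶ pullback sU (a1Struct k) :=
  pullback.lift (𝟙 U) (sU ≫ a1Zero k) (by simp)

theorem zeroSection_fst {U : Scheme.{0}} (sU : U ⟶ Spec (CommRingCat.of k)) :
    zeroSection sU ≫ pullback.fst sU (a1Struct k) = 𝟙 U :=
  pullback.lift_fst _ _ _

theorem zeroSection_fst_assoc {U Z : Scheme.{0}} (sU : U ⟶ Spec (CommRingCat.of k)) (g : U ⟶ Z) :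
    zeroSection sU ≫ pullback.fst sU (a1Struct k) ≫ g = g := by
  rw [← Category.assoc, zeroSection_fst, Category.id_comp]

theorem zeroSection_snd {U : Scheme.{0}} (sU : U ⟶ Spec (CommRingCat.of k)) :
    zeroSection sU ≫ pullback.snd sU (a1Struct k) = sU ≫ a1Zero k :=
  pullback.lift_snd _ _ _

/-- Over an affine chart `Spec A` of `U` with `A` reduced, every `k`-morphism from the affine line
over `U` to `𝔾ₘ` factors through the projection. -/
theorem comp_zeroSection_eq_of_spec {U : Scheme.{0}} (sU : U ⟶ Spec (CommRingCat.of k))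
    {A : CommRingCat.{0}} [_root_.IsReduced A] (i : Spec A ⟶ U)
    (h : pullback sU (a1Struct k) ⟶ Gm k)
    (hh : h ≫ gmStruct k = pullback.fst sU (a1Struct k) ≫ sU) :
    pullback.fst (pullback.fst sU (a1Struct k)) i ≫
        pullback.fst sU (a1Struct k) ≫ zeroSection sU ≫ h =
      pullback.fst (pullback.fst sU (a1Struct k)) i ≫ h := by
  obtain ⟨β, hβ⟩ := Spec.map_surjective (i ≫ sU)
  have hP := isPullback_a1Struct β
  let j : Spec (CommRingCat.of (Polynomial A)) ⟶ pullback sU (a1Struct k) :=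
    pullback.lift (Spec.map (CommRingCat.ofHom Polynomial.C) ≫ i)
      (specMapOf (Polynomial.mapRingHom β.hom)) (by rw [Category.assoc, ← hβ]; exact hP.w)
  have hj₁ : j ≫ pullback.fst sU (a1Struct k) =
      Spec.map (CommRingCat.ofHom Polynomial.C) ≫ i := pullback.lift_fst _ _ _
  have hj₂ : j ≫ pullback.snd sU (a1Struct k) = specMapOf (Polynomial.mapRingHom β.hom) :=
    pullback.lift_snd _ _ _
  have hsq : IsPullback j (Spec.map (CommRingCat.ofHom (Polynomial.C : A →+* Polynomial A)))
      (pullback.fst sU (a1Struct k)) i := by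
    refine IsPullback.of_right ?_ hj₁ (IsPullback.of_hasPullback sU (a1Struct k)).flip
    rw [hj₂, ← hβ]
    exact hP.flip
  have hz : j ≫ pullback.fst sU (a1Struct k) ≫ zeroSection sU =
      specMapOf (Polynomial.C.comp (Polynomial.evalRingHom (0 : A))) ≫ j := by
    apply pullback.hom_ext
    · simp only [Category.assoc, zeroSection_fst, Category.comp_id, hj₁]
      rw [specMapOf, ← Spec.map_comp_assoc, ← CommRingCat.ofHom_comp]
      congr 3
      ext x
      simp
    · simp only [Category.assoc, zeroSection_snd, hj₂]
      rw [← Category.assoc j, hj₁, Category.assoc, ← Category.assoc i, ← hβ]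
      simp only [a1Zero, specMapOf, ← Spec.map_comp]
      congr 1
      ext x
      · simp
      · simp
  have hjh : j ≫ pullback.fst sU (a1Struct k) ≫ zeroSection sU ≫ h = j ≫ h := by
    obtain ⟨φ, hφ⟩ := Spec.map_surjective (j ≫ h)
    have hk : j ≫ h ≫ gmStruct k = Spec.map (CommRingCat.ofHom Polynomial.C) ≫ Spec.map β := by
      rw [hh, ← Category.assoc, hj₁, Category.assoc, hβ]
    rw [← Category.assoc, ← hφ, gmStruct, specMapOf, ← Spec.map_comp, ← Spec.map_comp] at hk
    have hφ' := Polynomial.C_comp_eval_zero_comp_eq β.hom φ.hom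
      (congrArg CommRingCat.Hom.hom (Spec.map_injective hk))
    rw [← Category.assoc (pullback.fst sU (a1Struct k)), ← Category.assoc j, hz, Category.assoc,
      ← hφ, specMapOf, ← Spec.map_comp]
    exact congrArg Spec.map (CommRingCat.hom_ext hφ')
  rw [← hsq.isoPullback_inv_fst]
  simp only [Category.assoc, hjh]

end AffineLine

/-- For every reduced `k`-scheme `U`, precomposition with the projection `U ×ₖ 𝔸¹_k ⟶ U` is a
bijection `Hom_k(U, 𝔾ₘ) → Hom_k(U ×ₖ 𝔸¹_k, 𝔾ₘ)`; in particular `𝔾ₘ` is `𝔸¹`-rigid. -/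
theorem gm_a1Rigid_on_reduced
    (k : Type) [Field k]
    (U : Scheme) (sU : U ⟶ Spec (CommRingCat.of k)) (hU : IsReduced U) :
    (∀ f g : U ⟶ Gm k, f ≫ gmStruct k = sU → g ≫ gmStruct k = sU →
        pullback.fst sU (a1Struct k) ≫ f = pullback.fst sU (a1Struct k) ≫ g → f = g) ∧
    (∀ h : pullback sU (a1Struct k) ⟶ Gm k,
        h ≫ gmStruct k = pullback.fst sU (a1Struct k) ≫ sU →
        ∃ f : U ⟶ Gm k, f ≫ gmStruct k = sU ∧ pullback.fst sU (a1Struct k) ≫ f = h) := by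
  refine ⟨fun f g _ _ hfg => ?_, fun h hh => ⟨zeroSection sU ≫ h, ?_, ?_⟩⟩
  · simpa [zeroSection_fst_assoc] using congrArg (zeroSection sU ≫ ·) hfg
  · rw [Category.assoc, hh, zeroSection_fst_assoc]
  · let 𝒰 := U.affineOpenCover
    refine Scheme.Cover.hom_ext (𝒰.openCover.pullback₁ (pullback.fst sU (a1Struct k))) _ _
      fun (x : 𝒰.openCover.I₀) => ?_
    have hx : IsReduced (𝒰.openCover.X x) := inferInstance
    have : _root_.IsReduced (𝒰.X x) := (affine_isReduced_iff (𝒰.X x)).mp hx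
    exact comp_zeroSection_eq_of_spec sU (𝒰.f x) h hh

end
end
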